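/- Let G be a group and H a subgroup. The hypergroups G/H and H\G (left and right coset hypergroups) are isomorphic if and only if H is a normal subgroup of G. -/

import Mathlib

/-- Product of two subsets under a multivalued operation: union of elementwise products. -/
def hProd {α : Type*} (m : α → α → Set α) (A B : Set α) : Set α :=
  ⋃ a ∈ A, ⋃ b ∈ B, m a b

/-- Associativity of a multivalued operation. -/
def HAssoc {α : Type*} (m : α → α → Set α) : Prop :=
  ∀ x y z : α, hProd m (m x y) {z} = hProd m {x} (m y z)

/-- Reproductivity: x.H = H = H.x. -/
def HRepro {α : Type*} (m : α → α → Set α) : Prop :=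
  ∀ x : α, hProd m {x} Set.univ = Set.univ ∧ hProd m Set.univ {x} = Set.univ

/-- A hypergroup: nonempty carrier with associative, reproductive multivalued operation. -/
def IsHypergroup {α : Type*} (m : α → α → Set α) : Prop :=
  Nonempty α ∧ HAssoc m ∧ HRepro m
/-- A morphism of multivalued structures: f(x.y) = f(x).f(y). -/
def HMorph {α β : Type*} (m₁ : α → α → Set α) (m₂ : β → β → Set β) (f : α → β) : Prop :=
  ∀ x y : α, f '' (m₁ x y) = m₂ (f x) (f y)
/-- An isomorphism: a bijective morphism whose inverse is also a morphism. -/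
def HIso {α β : Type*} [Nonempty α] (m₁ : α → α → Set α) (m₂ : β → β → Set β) (f : α → β) : Prop :=
  Function.Bijective f ∧ HMorph m₁ m₂ f ∧ HMorph m₂ m₁ (Function.invFun f)
/-- The multivalued operation on left cosets: (xH).(yH) = {xhyH : h ∈ H}. -/
def cosetMul (G : Type*) [Group G] (H : Subgroup G) (a b : G ⧸ H) : Set (G ⧸ H) :=
  {c | ∃ x y h : G, h ∈ H ∧ a = (x : G ⧸ H) ∧ b = (y : G ⧸ H) ∧ c = ((x * h * y : G) : G ⧸ H)}
/-- The multivalued operation on right cosets: (Hx).(Hy) = {Hxhy : h ∈ H}. -/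
def rcosetMul (G : Type*) [Group G] (H : Subgroup G)
    (a b : Quotient (QuotientGroup.rightRel H)) :
    Set (Quotient (QuotientGroup.rightRel H)) :=
  {c | ∃ x y h : G, h ∈ H ∧
    a = Quotient.mk (QuotientGroup.rightRel H) x ∧
    b = Quotient.mk (QuotientGroup.rightRel H) y ∧
    c = Quotient.mk (QuotientGroup.rightRel H) (x * h * y)}

/-- The inverse of a bijective morphism is a morphism. -/
theorem HMorph.invFun {α β : Type*} [Nonempty α] {m₁ : α → α → Set α} {m₂ : β → β → Set β}
    {f : α → β} (hf : HMorph m₁ m₂ f) (hb : Function.Bijective f) :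
    HMorph m₂ m₁ (Function.invFun f) := by
  intro x y
  obtain ⟨a, rfl⟩ := hb.2 x
  obtain ⟨b, rfl⟩ := hb.2 y
  have hl := Function.leftInverse_invFun hb.1
  rw [← hf, hl.image_image, hl a, hl b]

theorem cosetMul_one (G : Type*) [Group G] (H : Subgroup G) (a : G ⧸ H) :
    cosetMul G H a ((1 : G) : G ⧸ H) = {a} := by
  ext c
  constructor
  · rintro ⟨x, y, h, hh, rfl, hy, rfl⟩
    have hy' : y ∈ H := by simpa using QuotientGroup.eq.1 hy
    refine QuotientGroup.eq.2 ?_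
    simpa [mul_assoc] using H.mul_mem (H.inv_mem hy') (H.inv_mem hh)
  · rintro rfl
    induction c using QuotientGroup.induction_on with
    | H x => exact ⟨x, 1, 1, H.one_mem, rfl, rfl, by simp⟩

theorem mk_mul_mem_rcosetMul_one {G : Type*} [Group G] (H : Subgroup G) (x : G) {h : G}
    (hh : h ∈ H) :
    Quotient.mk (QuotientGroup.rightRel H) (x * h) ∈
      rcosetMul G H (Quotient.mk _ x) (Quotient.mk _ 1) :=
  ⟨x, 1, h, hh, rfl, rfl, by rw [mul_one]⟩

theorem mem_rcosetMul_one_left {G : Type*} [Group G] (H : Subgroup G)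
    (b : Quotient (QuotientGroup.rightRel H)) :
    b ∈ rcosetMul G H (Quotient.mk _ 1) b := by
  induction b using Quotient.inductionOn with
  | h y => exact ⟨1, y, 1, H.one_mem, rfl, rfl, by simp⟩

/-- For a normal subgroup, the map sending `xH` to `Hx`. -/
def leftToRightCoset {G : Type*} [Group G] (H : Subgroup G) (hH : H.Normal) :
    G ⧸ H → Quotient (QuotientGroup.rightRel H) :=
  Quotient.map id fun x y hxy => by
    rw [id, id]
    exact QuotientGroup.rightRel_apply.2 (hH.mem_comm (QuotientGroup.leftRel_apply.1 hxy))

theorem leftToRightCoset_bijective {G : Type*} [Group G] (H : Subgroup G) (hH : H.Normal) :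
    Function.Bijective (leftToRightCoset H hH) := by
  constructor
  · intro a b
    induction a using QuotientGroup.induction_on with
    | H x =>
      induction b using QuotientGroup.induction_on with
      | H y =>
        intro hxy
        exact QuotientGroup.eq.2
          (hH.mem_comm (QuotientGroup.rightRel_apply.1 (Quotient.exact hxy)))
  · intro b
    induction b using Quotient.inductionOn with
    | h y => exact ⟨(y : G ⧸ H), rfl⟩

theorem leftToRightCoset_hMorph {G : Type*} [Group G] (H : Subgroup G) (hH : H.Normal) :
    HMorph (cosetMul G H) (rcosetMul G H) (leftToRightCoset H hH) := by
  have hinj := (leftToRightCoset_bijective H hH).1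
  intro a b
  ext c
  constructor
  · rintro ⟨_, ⟨x, y, h, hh, rfl, rfl, rfl⟩, rfl⟩
    exact ⟨x, y, h, hh, rfl, rfl, rfl⟩
  · rintro ⟨x, y, h, hh, hx, hy, rfl⟩
    exact ⟨((x * h * y : G) : G ⧸ H),
      ⟨x, y, h, hh, hinj (hx.trans rfl), hinj (hy.trans rfl), rfl⟩, rfl⟩

theorem leftCosets_iso_rightCosets_iff_normal {G : Type*} [Group G] (H : Subgroup G) :
    (∃ f : G ⧸ H → Quotient (QuotientGroup.rightRel H),
      HIso (cosetMul G H) (rcosetMul G H) f) ↔ H.Normal := by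
  constructor
  · rintro ⟨f, hb, hf, -⟩
    have hid : ∀ b, rcosetMul G H b (f ((1 : G) : G ⧸ H)) = {b} := by
      intro b
      obtain ⟨a, rfl⟩ := hb.2 b
      rw [← hf, cosetMul_one, Set.image_singleton]
    have hone : f ((1 : G) : G ⧸ H) = Quotient.mk _ 1 := by
      have hmem := mem_rcosetMul_one_left H (f ((1 : G) : G ⧸ H))
      rwa [hid] at hmem
    refine ⟨fun h hh x => ?_⟩
    have hmem := mk_mul_mem_rcosetMul_one H x hh
    rw [← hone, hid] at hmem
    have hrel := QuotientGroup.rightRel_apply.1 (Quotient.exact hmem)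
    simpa [mul_assoc] using H.inv_mem hrel
  · intro hH
    have hb := leftToRightCoset_bijective H hH
    have hm := leftToRightCoset_hMorph H hH
    exact ⟨leftToRightCoset H hH, hb, hm, hm.invFun hb⟩
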